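/- Let Q and Q′ be normal coordinates for germs at 0 of real-analytic hypersurfaces M, M′ ⊂ ℂ², neither Levi-flat near 0, with invariants (m₀, α₀, μ₀) and (m₀′, α₀′, μ₀′) respectively. If there exists a local biholomorphism H : (ℂ²,0) → (ℂ²,0) satisfying the mapping identity for (Q,Q′), then α₀ = α₀′ and μ₀ = μ₀′ (and hence m₀ = m₀′); that is, the integers m₀, α₀, μ₀ are biholomorphic invariants. -/

import Mathlib

open Filter Topology Matrix

noncomputable section

/-- Complex conjugation as a plain function. -/
def cj : ℂ → ℂ := (starRingEnd ℂ)

/-- Iterated partial derivative `∂_z^i ∂_w^j F (z, w)` of `F : ℂ → ℂ → ℂ`. -/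
def pd (F : ℂ → ℂ → ℂ) (i j : ℕ) (z w : ℂ) : ℂ :=
  deriv^[i] (fun z' => deriv^[j] (F z') w) z

/-- `Q` is a normal-coordinates defining function (near `0`) of a germ of a
real-analytic hypersurface in `ℂ²`. -/
def IsNormalCoord (Q : ℂ → ℂ → ℂ → ℂ) : Prop :=
  AnalyticAt ℂ (fun p : ℂ × ℂ × ℂ => Q p.1 p.2.1 p.2.2) 0 ∧
  (∀ᶠ p : ℂ × ℂ in 𝓝 0, Q p.1 0 p.2 = p.2) ∧
  (∀ᶠ p : ℂ × ℂ in 𝓝 0, Q 0 p.1 p.2 = p.2) ∧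
  (∀ᶠ p : ℂ × ℂ × ℂ in 𝓝 0, Q p.1 p.2.1 (cj (Q (cj p.2.1) (cj p.1) (cj p.2.2))) = p.2.2)

/-- The mapping identity expressing that the germ at `0` of the holomorphic map
`H = (F, G)` (with `H(0) = 0`) sends the hypersurface defined by `Q` into the one
defined by `Q'`. -/
def SendsInto (Q Q' : ℂ → ℂ → ℂ → ℂ) (F G : ℂ → ℂ → ℂ) : Prop :=
  AnalyticAt ℂ (fun p : ℂ × ℂ => F p.1 p.2) 0 ∧
  AnalyticAt ℂ (fun p : ℂ × ℂ => G p.1 p.2) 0 ∧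
  F 0 0 = 0 ∧ G 0 0 = 0 ∧
  ∀ᶠ p : ℂ × ℂ × ℂ in 𝓝 0,
    G p.1 (Q p.1 p.2.1 p.2.2) =
      Q' (F p.1 (Q p.1 p.2.1 p.2.2)) (cj (F (cj p.2.1) (cj p.2.2))) (cj (G (cj p.2.1) (cj p.2.2)))

/-- Determinant of the Jacobian matrix of `H = (F, G)` at `0`. -/
def JacDet (F G : ℂ → ℂ → ℂ) : ℂ :=
  pd F 1 0 0 0 * pd G 0 1 0 0 - pd F 0 1 0 0 * pd G 1 0 0 0

/-- The hypersurface defined by `Q` is not Levi-flat near `0`, i.e. `Q(z,χ,τ) ≢ τ`. -/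
def NotLeviFlat (Q : ℂ → ℂ → ℂ → ℂ) : Prop :=
  ¬ ∀ᶠ p : ℂ × ℂ × ℂ in 𝓝 0, Q p.1 p.2.1 p.2.2 = p.2.2

/-- The hypersurface defined by `Q` is of finite type at `0`, i.e. `Q(z,χ,0) ≢ 0`. -/
def FiniteTypeAt (Q : ℂ → ℂ → ℂ → ℂ) : Prop :=
  ¬ ∀ᶠ p : ℂ × ℂ in 𝓝 0, Q p.1 p.2 0 = 0

/-- `q_{αμ}(χ) = ∂_z^α ∂_τ^μ Q(0, χ, 0)`. -/
def qd (Q : ℂ → ℂ → ℂ → ℂ) (α μ : ℕ) (χ : ℂ) : ℂ :=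
  deriv^[α] (fun z => deriv^[μ] (fun τ => Q z χ τ) 0) 0

/-- The hypersurface (germ) defined by `Q` as a subset of `ℂ²`. -/
def MSet (Q : ℂ → ℂ → ℂ → ℂ) : Set (ℂ × ℂ) := {p | p.2 = Q p.1 (cj p.1) (cj p.2)}

/-- `q_{αμ} ≢ 0` as a germ at `0`. -/
def QNontriv (Q : ℂ → ℂ → ℂ → ℂ) (α μ : ℕ) : Prop :=
  ¬ ∀ᶠ χ : ℂ in 𝓝 0, qd Q α μ χ = 0

/-- `(α₀, μ₀)` are the invariants of the (non-Levi-flat) hypersurface defined by `Q`: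
`α₀ ≥ 1`, `q_{α₀μ₀} ≢ 0`, the total order `m₀ = α₀ + μ₀` is minimal among pairs `(α, μ)`
with `α ≥ 1` and `q_{αμ} ≢ 0`, and `μ₀` is minimal at that total order. -/
def IsInvariants (Q : ℂ → ℂ → ℂ → ℂ) (α₀ μ₀ : ℕ) : Prop :=
  1 ≤ α₀ ∧ QNontriv Q α₀ μ₀ ∧
  (∀ α μ : ℕ, 1 ≤ α → QNontriv Q α μ → α₀ + μ₀ ≤ α + μ) ∧
  (∀ α μ : ℕ, 1 ≤ α → QNontriv Q α μ → α + μ = α₀ + μ₀ → μ₀ ≤ μ)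

/-- Partial derivative in the first variable of a function on `ℂ³`. -/
def dz (f : ℂ × ℂ × ℂ → ℂ) (p : ℂ × ℂ × ℂ) : ℂ :=
  deriv (fun z => f (z, p.2)) p.1

/-- Partial derivative in the third variable of a function on `ℂ³`. -/
def dt (f : ℂ × ℂ × ℂ → ℂ) (p : ℂ × ℂ × ℂ) : ℂ :=
  deriv (fun τ => f (p.1, p.2.1, τ)) p.2.2

/-- The coefficient `∂_z^i ∂_τ^j f (0, y, 0)`. -/
def cd (f : ℂ × ℂ × ℂ → ℂ) (i j : ℕ) (y : ℂ) : ℂ :=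
  dz^[i] (dt^[j] f) (0, y, 0)

theorem dz_eq_fderiv {f : ℂ × ℂ × ℂ → ℂ} {p : ℂ × ℂ × ℂ} (hf : DifferentiableAt ℂ f p) :
    dz f p = fderiv ℂ f p (1, 0, 0) := by
  have h1 : HasDerivAt (fun z : ℂ => (z, p.2)) ((1 : ℂ), (0 : ℂ × ℂ)) p.1 :=
    (hasDerivAt_id p.1).prodMk (hasDerivAt_const p.1 p.2)
  exact (HasFDerivAt.comp_hasDerivAt p.1 (f := fun z : ℂ => (z, p.2)) hf.hasFDerivAt h1).deriv

theorem dt_eq_fderiv {f : ℂ × ℂ × ℂ → ℂ} {p : ℂ × ℂ × ℂ} (hf : DifferentiableAt ℂ f p) :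
    dt f p = fderiv ℂ f p (0, 0, 1) := by
  have h1 : HasDerivAt (fun τ : ℂ => (p.1, p.2.1, τ)) ((0 : ℂ), (0 : ℂ), (1 : ℂ)) p.2.2 :=
    (hasDerivAt_const _ _).prodMk ((hasDerivAt_const _ _).prodMk (hasDerivAt_id _))
  exact (HasFDerivAt.comp_hasDerivAt p.2.2 (f := fun τ : ℂ => (p.1, p.2.1, τ))
    hf.hasFDerivAt h1).deriv

theorem dz_congr {f g : ℂ × ℂ × ℂ → ℂ} {p : ℂ × ℂ × ℂ} (h : f =ᶠ[𝓝 p] g) : dz f p = dz g p := by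
  apply Filter.EventuallyEq.deriv_eq
  have : Tendsto (fun z : ℂ => (z, p.2)) (𝓝 p.1) (𝓝 p) := by
    apply Continuous.tendsto'
    · fun_prop
    · rfl
  exact this.eventually h

theorem dt_congr {f g : ℂ × ℂ × ℂ → ℂ} {p : ℂ × ℂ × ℂ} (h : f =ᶠ[𝓝 p] g) : dt f p = dt g p := by
  apply Filter.EventuallyEq.deriv_eq
  have : Tendsto (fun τ : ℂ => (p.1, p.2.1, τ)) (𝓝 p.2.2) (𝓝 p) := by
    apply Continuous.tendsto'
    · fun_prop
    · rfl
  exact this.eventually h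

theorem dz_eventuallyEq {f : ℂ × ℂ × ℂ → ℂ} {p : ℂ × ℂ × ℂ} (hf : AnalyticAt ℂ f p) :
    dz f =ᶠ[𝓝 p] fun q => fderiv ℂ f q (1, 0, 0) := by
  filter_upwards [hf.eventually_analyticAt] with q hq using dz_eq_fderiv hq.differentiableAt

theorem dt_eventuallyEq {f : ℂ × ℂ × ℂ → ℂ} {p : ℂ × ℂ × ℂ} (hf : AnalyticAt ℂ f p) :
    dt f =ᶠ[𝓝 p] fun q => fderiv ℂ f q (0, 0, 1) := by
  filter_upwards [hf.eventually_analyticAt] with q hq using dt_eq_fderiv hq.differentiableAt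

theorem analyticAt_dz {f : ℂ × ℂ × ℂ → ℂ} {p : ℂ × ℂ × ℂ} (hf : AnalyticAt ℂ f p) :
    AnalyticAt ℂ (dz f) p :=
  AnalyticAt.congr (((ContinuousLinearMap.apply ℂ ℂ ((1, 0, 0) : ℂ × ℂ × ℂ)).analyticAt _).comp hf.fderiv)
    (dz_eventuallyEq hf).symm

theorem analyticAt_dt {f : ℂ × ℂ × ℂ → ℂ} {p : ℂ × ℂ × ℂ} (hf : AnalyticAt ℂ f p) :
    AnalyticAt ℂ (dt f) p :=
  AnalyticAt.congr (((ContinuousLinearMap.apply ℂ ℂ ((0, 0, 1) : ℂ × ℂ × ℂ)).analyticAt _).comp hf.fderiv)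
    (dt_eventuallyEq hf).symm

theorem analyticAt_dz_iterate {f : ℂ × ℂ × ℂ → ℂ} {p : ℂ × ℂ × ℂ} (hf : AnalyticAt ℂ f p)
    (i : ℕ) : AnalyticAt ℂ (dz^[i] f) p := by
  induction i with
  | zero => exact hf
  | succ i ih => rw [Function.iterate_succ_apply']; exact analyticAt_dz ih

theorem analyticAt_dt_iterate {f : ℂ × ℂ × ℂ → ℂ} {p : ℂ × ℂ × ℂ} (hf : AnalyticAt ℂ f p)
    (i : ℕ) : AnalyticAt ℂ (dt^[i] f) p := by
  induction i with
  | zero => exact hf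
  | succ i ih => rw [Function.iterate_succ_apply']; exact analyticAt_dt ih

theorem dz_dt_comm {f : ℂ × ℂ × ℂ → ℂ} {p : ℂ × ℂ × ℂ} (hf : AnalyticAt ℂ f p) :
    dz (dt f) p = dt (dz f) p := by
  have hd : DifferentiableAt ℂ (fderiv ℂ f) p := hf.fderiv.differentiableAt
  have hs : IsSymmSndFDerivAt ℂ f p :=
    ContDiffAt.isSymmSndFDerivAt (n := ⊤) hf.contDiffAt (by simp)
  rw [dz_congr (dt_eventuallyEq hf), dt_congr (dz_eventuallyEq hf),
    dz_eq_fderiv (hd.clm_apply (differentiableAt_const _)),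
    dt_eq_fderiv (hd.clm_apply (differentiableAt_const _)),
    fderiv_clm_apply hd (differentiableAt_const _), fderiv_clm_apply hd (differentiableAt_const _)]
  simpa using hs.eq (1, 0, 0) (0, 0, 1)

theorem dt_iterate_dz {f : ℂ × ℂ × ℂ → ℂ} {p : ℂ × ℂ × ℂ} (hf : AnalyticAt ℂ f p) (j : ℕ) :
    dt^[j] (dz f) p = dz (dt^[j] f) p := by
  induction j generalizing p with
  | zero => rfl
  | succ j ih =>
    rw [Function.iterate_succ_apply', Function.iterate_succ_apply',
      dz_dt_comm (analyticAt_dt_iterate hf j)]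
    exact dt_congr (by filter_upwards [hf.eventually_analyticAt] with q hq using ih hq)

theorem dz_iterate_congr {f g : ℂ × ℂ × ℂ → ℂ} {p : ℂ × ℂ × ℂ} (h : f =ᶠ[𝓝 p] g) (i : ℕ) :
    dz^[i] f =ᶠ[𝓝 p] dz^[i] g := by
  induction i with
  | zero => exact h
  | succ i ih =>
    simp only [Function.iterate_succ_apply']
    filter_upwards [ih.eventuallyEq_nhds] with q hq using dz_congr hq

theorem cd_dz {f : ℂ × ℂ × ℂ → ℂ} {y : ℂ} (hf : AnalyticAt ℂ f (0, y, 0)) (i j : ℕ) :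
    cd (dz f) i j y = cd f (i + 1) j y := by
  have h : dt^[j] (dz f) =ᶠ[𝓝 (0, y, 0)] dz (dt^[j] f) := by
    filter_upwards [hf.eventually_analyticAt] with q hq using dt_iterate_dz hq j
  exact (dz_iterate_congr h i).eq_of_nhds

theorem cd_dt (f : ℂ × ℂ × ℂ → ℂ) (y : ℂ) (i j : ℕ) : cd (dt f) i j y = cd f i (j + 1) y :=
  rfl

/-- The homogeneous part of degree `m` of the Taylor expansion of `f (·, y, ·)` at `0`. -/
def homPart (f : ℂ × ℂ × ℂ → ℂ) (m : ℕ) (y x v : ℂ) : ℂ :=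
  ∑ ij ∈ Finset.HasAntidiagonal.antidiagonal m,
    x ^ ij.1 * v ^ ij.2 * cd f ij.1 ij.2 y / (ij.1.factorial * ij.2.factorial)

theorem homPart_succ {f : ℂ × ℂ × ℂ → ℂ} {y : ℂ} (hf : AnalyticAt ℂ f (0, y, 0)) (m : ℕ)
    (x v : ℂ) :
    (m + 1) * homPart f (m + 1) y x v = x * homPart (dz f) m y x v + v * homPart (dt f) m y x v := by
  have h1 : (m + 1) * homPart f (m + 1) y x v =
      ∑ ij ∈ Finset.HasAntidiagonal.antidiagonal (m + 1), (ij.1 : ℂ) *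
        (x ^ ij.1 * v ^ ij.2 * cd f ij.1 ij.2 y / (ij.1.factorial * ij.2.factorial)) +
      ∑ ij ∈ Finset.HasAntidiagonal.antidiagonal (m + 1), (ij.2 : ℂ) *
        (x ^ ij.1 * v ^ ij.2 * cd f ij.1 ij.2 y / (ij.1.factorial * ij.2.factorial)) := by
    rw [homPart, Finset.mul_sum, ← Finset.sum_add_distrib]
    refine Finset.sum_congr rfl fun ij hij => ?_
    have : (ij.1 : ℂ) + ij.2 = m + 1 := by exact_mod_cast Finset.HasAntidiagonal.mem_antidiagonal.1 hij
    rw [← this]; ring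
  rw [h1, Finset.Nat.sum_antidiagonal_succ, Finset.Nat.sum_antidiagonal_succ', homPart, homPart,
    Finset.mul_sum, Finset.mul_sum]
  simp only [Nat.cast_zero, zero_mul, zero_add]
  congr 1
  · refine Finset.sum_congr rfl fun ij _ => ?_
    rw [cd_dz hf, Nat.factorial_succ]
    have := Nat.cast_add_one_ne_zero (R := ℂ) ij.1
    have := Nat.cast_ne_zero (R := ℂ).2 ij.1.factorial_ne_zero
    have := Nat.cast_ne_zero (R := ℂ).2 ij.2.factorial_ne_zero
    push_cast
    field_simp
    ring
  · refine Finset.sum_congr rfl fun ij _ => ?_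
    rw [cd_dt, Nat.factorial_succ]
    have := Nat.cast_add_one_ne_zero (R := ℂ) ij.2
    have := Nat.cast_ne_zero (R := ℂ).2 ij.1.factorial_ne_zero
    have := Nat.cast_ne_zero (R := ℂ).2 ij.2.factorial_ne_zero
    push_cast
    field_simp
    ring

theorem hasDerivAt_scale {f : ℂ × ℂ × ℂ → ℂ} {t x y v : ℂ}
    (hf : AnalyticAt ℂ f (t * x, y, t * v)) :
    HasDerivAt (fun t => f (t * x, y, t * v))
      (x * dz f (t * x, y, t * v) + v * dt f (t * x, y, t * v)) t := by
  have h1 : HasDerivAt (fun t : ℂ => (t * x, y, t * v)) (x, (0 : ℂ), v) t := by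
    have := ((hasDerivAt_id t).mul_const x).prodMk
      ((hasDerivAt_const t y).prodMk ((hasDerivAt_id t).mul_const v))
    simpa using this
  have h2 := HasFDerivAt.comp_hasDerivAt t (f := fun t : ℂ => (t * x, y, t * v))
    hf.differentiableAt.hasFDerivAt h1
  refine h2.congr_deriv ?_
  rw [dz_eq_fderiv hf.differentiableAt, dt_eq_fderiv hf.differentiableAt]
  have : ((x, (0 : ℂ), v) : ℂ × ℂ × ℂ) = x • (1, 0, 0) + v • (0, 0, 1) := by simp
  rw [this, map_add, map_smul, map_smul]
  rfl

theorem norm_sub_homPart_le (m : ℕ) {f : ℂ × ℂ × ℂ → ℂ} {y₀ : ℂ}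
    (hf : AnalyticAt ℂ f (0, y₀, 0))
    (hv : ∀ᶠ y in 𝓝 y₀, ∀ i j, i + j < m → cd f i j y = 0) (x₀ v₀ : ℂ) {ε : ℝ} (hε : 0 < ε) :
    ∀ᶠ p : ℂ × ℂ × ℂ × ℂ in 𝓝 (0, x₀, y₀, v₀),
      ‖f (p.1 * p.2.1, p.2.2.1, p.1 * p.2.2.2) - p.1 ^ m * homPart f m y₀ x₀ v₀‖
        ≤ ε * ‖p.1‖ ^ m := by
  have hcont : Tendsto (fun p : ℂ × ℂ × ℂ × ℂ => (p.1 * p.2.1, p.2.2.1, p.1 * p.2.2.2))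
      (𝓝 (0, x₀, y₀, v₀)) (𝓝 (0, y₀, 0)) := by
    apply Continuous.tendsto'
    · fun_prop
    · simp
  induction m generalizing f ε with
  | zero =>
    have h0 : homPart f 0 y₀ x₀ v₀ = f (0, y₀, 0) := by simp [homPart, cd]
    have := (hf.continuousAt.tendsto.comp hcont).eventually (Metric.closedBall_mem_nhds _ hε)
    filter_upwards [this] with p hp
    simpa [h0, dist_eq_norm] using hp
  | succ m ih =>
    have hyt : Tendsto (fun y : ℂ => ((0 : ℂ), y, (0 : ℂ))) (𝓝 y₀) (𝓝 (0, y₀, 0)) := by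
      apply Continuous.tendsto'
      · fun_prop
      · rfl
    have hya := hyt.eventually hf.eventually_analyticAt
    have hvz : ∀ᶠ y in 𝓝 y₀, ∀ i j, i + j < m → cd (dz f) i j y = 0 := by
      filter_upwards [hv, hya] with y hy hy' i j hij
      rw [cd_dz hy']
      exact hy _ _ (by omega)
    have hvt : ∀ᶠ y in 𝓝 y₀, ∀ i j, i + j < m → cd (dt f) i j y = 0 := by
      filter_upwards [hv] with y hy i j hij
      rw [cd_dt]
      exact hy _ _ (by omega)
    set Pz := homPart (dz f) m y₀ x₀ v₀
    set Pt := homPart (dt f) m y₀ x₀ v₀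
    set P := homPart f (m + 1) y₀ x₀ v₀
    have hP : (m + 1) * P = x₀ * Pz + v₀ * Pt := homPart_succ hf m x₀ v₀
    obtain ⟨δ, hδ, hδε⟩ : ∃ δ : ℝ, 0 < δ ∧ (‖x₀‖ + 1) * δ + (‖v₀‖ + 1) * δ ≤ ε / 2 := by
      refine ⟨ε / 2 / (‖x₀‖ + 1 + (‖v₀‖ + 1)), by positivity, ?_⟩
      rw [← add_mul, mul_div_cancel₀]
      positivity
    have e1 := ih (analyticAt_dz hf) hvz hδ
    have e2 := ih (analyticAt_dt hf) hvt hδ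
    have e3 : ∀ᶠ p : ℂ × ℂ × ℂ × ℂ in 𝓝 (0, x₀, y₀, v₀),
        ‖p.2.1 * Pz + p.2.2.2 * Pt - (m + 1) * P‖ < ε / 2 ∧ ‖p.2.1‖ < ‖x₀‖ + 1 ∧
          ‖p.2.2.2‖ < ‖v₀‖ + 1 := by
      refine Filter.Eventually.and ?_ (Filter.Eventually.and ?_ ?_)
      · apply ContinuousAt.eventually_lt (by fun_prop) (by fun_prop)
        simp [hP, hε]
      · exact ContinuousAt.eventually_lt (by fun_prop) (by fun_prop) (by simp)
      · exact ContinuousAt.eventually_lt (by fun_prop) (by fun_prop) (by simp)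
    have e4 : ∀ᶠ p : ℂ × ℂ × ℂ × ℂ in 𝓝 (0, x₀, y₀, v₀), f (0, p.2.2.1, 0) = 0 := by
      have : Tendsto (fun p : ℂ × ℂ × ℂ × ℂ => p.2.2.1) (𝓝 (0, x₀, y₀, v₀)) (𝓝 y₀) := by
        apply Continuous.tendsto'
        · fun_prop
        · rfl
      filter_upwards [this.eventually hv] with p hp
      simpa [cd] using hp 0 0 (by omega)
    have e5 := hcont.eventually hf.eventually_analyticAt
    obtain ⟨r, hr, hball⟩ := Metric.eventually_nhds_iff_ball.1
      ((e1.and e2).and ((e3.and e4).and e5))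
    filter_upwards [Metric.ball_mem_nhds _ hr] with p hp
    obtain ⟨t, x, y, v⟩ := p
    have hmem : ∀ s ∈ Metric.closedBall (0 : ℂ) ‖t‖,
        (s, x, y, v) ∈ Metric.ball ((0 : ℂ), x₀, y₀, v₀) r := by
      intro s hs
      simp only [Metric.mem_ball, Prod.dist_eq, max_lt_iff, dist_zero_right,
        Metric.mem_closedBall] at hp hs ⊢
      exact ⟨hs.trans_lt hp.1, hp.2⟩
    have hder : ∀ s ∈ Metric.closedBall (0 : ℂ) ‖t‖,
        HasDerivWithinAt (fun s => f (s * x, y, s * v) - s ^ (m + 1) * P)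
          (x * dz f (s * x, y, s * v) + v * dt f (s * x, y, s * v) - (m + 1) * s ^ m * P)
          (Metric.closedBall (0 : ℂ) ‖t‖) s := by
      intro s hs
      have h1 := hasDerivAt_scale (hball _ (hmem s hs)).2.2
      have h2 := (hasDerivAt_pow (m + 1) s).mul_const P
      exact ((h1.sub h2).congr_deriv (by simp)).hasDerivWithinAt
    have hbd : ∀ s ∈ Metric.closedBall (0 : ℂ) ‖t‖,
        ‖x * dz f (s * x, y, s * v) + v * dt f (s * x, y, s * v) - (m + 1) * s ^ m * P‖
          ≤ ε * ‖t‖ ^ m := by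
      intro s hs
      obtain ⟨⟨b1, b2⟩, ⟨⟨b3, b4, b5⟩, -⟩, -⟩ := hball _ (hmem s hs)
      simp only at b1 b2 b3 b4 b5
      have hst : ‖s‖ ≤ ‖t‖ := by simpa using hs
      have key : x * dz f (s * x, y, s * v) + v * dt f (s * x, y, s * v) - (m + 1) * s ^ m * P =
          x * (dz f (s * x, y, s * v) - s ^ m * Pz) + v * (dt f (s * x, y, s * v) - s ^ m * Pt) +
            s ^ m * (x * Pz + v * Pt - (m + 1) * P) := by ring
      rw [key]
      calc _ ≤ ‖x‖ * ‖dz f (s * x, y, s * v) - s ^ m * Pz‖ +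
            ‖v‖ * ‖dt f (s * x, y, s * v) - s ^ m * Pt‖ +
            ‖s‖ ^ m * ‖x * Pz + v * Pt - (m + 1) * P‖ := by
              refine norm_add₃_le.trans ?_
              simp only [norm_mul, norm_pow]
              exact le_rfl
        _ ≤ (‖x₀‖ + 1) * (δ * ‖s‖ ^ m) + (‖v₀‖ + 1) * (δ * ‖s‖ ^ m) + ‖s‖ ^ m * (ε / 2) := by
              gcongr
        _ = ((‖x₀‖ + 1) * δ + (‖v₀‖ + 1) * δ + ε / 2) * ‖s‖ ^ m := by ring
        _ ≤ ε * ‖s‖ ^ m := by gcongr; linarith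
        _ ≤ ε * ‖t‖ ^ m := by gcongr
    have hfin := (convex_closedBall (0 : ℂ) ‖t‖).norm_image_sub_le_of_norm_hasDerivWithin_le
      hder hbd (x := 0) (y := t) (by simp) (by simp)
    have h0 : f (0, y, 0) = 0 := (hball _ hp).2.1.2
    simpa [h0, pow_succ, mul_assoc] using hfin

theorem tendsto_div_pow_homPart {m : ℕ} {f : ℂ × ℂ × ℂ → ℂ} {y₀ : ℂ}
    (hf : AnalyticAt ℂ f (0, y₀, 0))
    (hv : ∀ᶠ y in 𝓝 y₀, ∀ i j, i + j < m → cd f i j y = 0) {x₀ v₀ : ℂ} {x y v : ℂ → ℂ}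
    (hx : Tendsto (fun t => x t / t) (𝓝[≠] 0) (𝓝 x₀)) (hy : Tendsto y (𝓝[≠] 0) (𝓝 y₀))
    (hv' : Tendsto (fun t => v t / t) (𝓝[≠] 0) (𝓝 v₀)) :
    Tendsto (fun t => f (x t, y t, v t) / t ^ m) (𝓝[≠] 0) (𝓝 (homPart f m y₀ x₀ v₀)) := by
  rw [Metric.tendsto_nhds]
  intro ε hε
  have ht : Tendsto (fun t : ℂ => t) (𝓝[≠] 0) (𝓝 0) := nhdsWithin_le_nhds
  have hT := ht.prodMk_nhds (hx.prodMk_nhds (hy.prodMk_nhds hv'))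
  filter_upwards [hT.eventually (norm_sub_homPart_le m hf hv x₀ v₀ (half_pos hε)),
    self_mem_nhdsWithin] with t h1 h2
  have h2' : t ≠ 0 := h2
  simp only [mul_div_cancel₀ _ h2'] at h1
  rw [dist_eq_norm]
  have : f (x t, y t, v t) / t ^ m - homPart f m y₀ x₀ v₀ =
      (f (x t, y t, v t) - t ^ m * homPart f m y₀ x₀ v₀) / t ^ m := by
    field_simp
  rw [this, norm_div, norm_pow, div_lt_iff₀ (by positivity)]
  have : 0 < ‖t‖ ^ m := by positivity
  nlinarith

/-- `homPart` as a polynomial in its third argument. -/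
def homPoly (f : ℂ × ℂ × ℂ → ℂ) (m : ℕ) (y v : ℂ) : Polynomial ℂ :=
  ∑ ij ∈ Finset.HasAntidiagonal.antidiagonal m,
    Polynomial.monomial ij.1 (v ^ ij.2 * cd f ij.1 ij.2 y / (ij.1.factorial * ij.2.factorial))

theorem eval_homPoly (f : ℂ × ℂ × ℂ → ℂ) (m : ℕ) (y x v : ℂ) :
    (homPoly f m y v).eval x = homPart f m y x v := by
  rw [homPoly, homPart, Polynomial.eval_finsetSum]
  refine Finset.sum_congr rfl fun ij _ => ?_
  rw [Polynomial.eval_monomial]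
  ring

theorem coeff_homPoly (f : ℂ × ℂ × ℂ → ℂ) (i j : ℕ) (y v : ℂ) :
    (homPoly f (i + j) y v).coeff i = v ^ j * cd f i j y / (i.factorial * j.factorial) := by
  rw [homPoly, Polynomial.finsetSum_coeff, Finset.sum_eq_single (i, j)]
  · simp
  · rintro ⟨k, l⟩ hkl hne
    rw [Finset.HasAntidiagonal.mem_antidiagonal] at hkl
    rw [Polynomial.coeff_monomial, if_neg]
    rintro rfl
    simp only at hkl hne
    exact hne (by rw [Nat.add_left_cancel hkl])
  · simp

theorem coeff_homPoly_ne_zero {f : ℂ × ℂ × ℂ → ℂ} {α μ : ℕ} {y v : ℂ} (hv : v ≠ 0)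
    (h : cd f α μ y ≠ 0) : (homPoly f (α + μ) y v).coeff α ≠ 0 := by
  rw [coeff_homPoly]
  have := Nat.cast_ne_zero (R := ℂ).2 α.factorial_ne_zero
  have := Nat.cast_ne_zero (R := ℂ).2 μ.factorial_ne_zero
  positivity

theorem natDegree_homPoly {f : ℂ × ℂ × ℂ → ℂ} {α μ : ℕ} {y v : ℂ} (hv : v ≠ 0)
    (h : cd f α μ y ≠ 0) (h' : ∀ i j, i + j = α + μ → α < i → cd f i j y = 0) :
    (homPoly f (α + μ) y v).natDegree = α := by
  refine Polynomial.natDegree_eq_of_le_of_coeff_ne_zero ?_ (coeff_homPoly_ne_zero hv h)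
  refine Polynomial.natDegree_sum_le_of_forall_le _ _ fun ij hij => ?_
  rw [Finset.HasAntidiagonal.mem_antidiagonal] at hij
  rcases le_or_gt ij.1 α with hle | hlt
  · exact (Polynomial.natDegree_monomial_le _).trans hle
  · simp [h' _ _ hij hlt]

/-- The function `Q(z, χ, τ) - τ` on `ℂ³`. -/
def defect (Q : ℂ → ℂ → ℂ → ℂ) (p : ℂ × ℂ × ℂ) : ℂ :=
  Q p.1 p.2.1 p.2.2 - p.2.2

theorem dz_iterate_apply (f : ℂ × ℂ × ℂ → ℂ) (i : ℕ) (p : ℂ × ℂ × ℂ) :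
    dz^[i] f p = deriv^[i] (fun z => f (z, p.2)) p.1 := by
  induction i generalizing p with
  | zero => rfl
  | succ i ih =>
    rw [Function.iterate_succ_apply', Function.iterate_succ_apply', dz]
    simp only [ih]

theorem dt_iterate_apply (f : ℂ × ℂ × ℂ → ℂ) (j : ℕ) (p : ℂ × ℂ × ℂ) :
    dt^[j] f p = deriv^[j] (fun τ => f (p.1, p.2.1, τ)) p.2.2 := by
  induction j generalizing p with
  | zero => rfl
  | succ i ih =>
    rw [Function.iterate_succ_apply', Function.iterate_succ_apply', dt]
    simp only [ih]

theorem cd_eq_qd (Q : ℂ → ℂ → ℂ → ℂ) (i j : ℕ) (y : ℂ) :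
    cd (fun p => Q p.1 p.2.1 p.2.2) i j y = qd Q i j y := by
  simp only [cd, qd, dz_iterate_apply, dt_iterate_apply]

theorem iterate_deriv_eq_zero {g : ℂ → ℂ} {x : ℂ} (h : ∀ᶠ y in 𝓝 x, g y = 0) (n : ℕ) :
    deriv^[n] g x = 0 := by
  have h' : g =ᶠ[𝓝 x] fun _ => 0 := h
  have := h'.iteratedDeriv_eq n
  rw [iteratedDeriv_eq_iterate, iteratedDeriv_eq_iterate] at this
  rw [this, ← iteratedDeriv_eq_iterate]
  simp

theorem dz_defect {Q : ℂ → ℂ → ℂ → ℂ} : dz (defect Q) = dz (fun p => Q p.1 p.2.1 p.2.2) := by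
  funext p
  simp only [dz, defect, deriv_sub_const]

section NormalCoord

variable {Q : ℂ → ℂ → ℂ → ℂ}

theorem analyticAt_defect (hQ : IsNormalCoord Q) : AnalyticAt ℂ (defect Q) 0 :=
  hQ.1.sub ((analyticAt_snd (𝕜 := ℂ)).comp analyticAt_snd)

theorem eventually_cd_defect (hQ : IsNormalCoord Q) :
    ∀ᶠ χ in 𝓝 (0 : ℂ), ∀ i j, cd (defect Q) (i + 1) j χ = qd Q (i + 1) j χ := by
  have hc : Tendsto (fun y : ℂ => ((0 : ℂ), y, (0 : ℂ))) (𝓝 0) (𝓝 0) :=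
    Continuous.tendsto' (by fun_prop) _ _ rfl
  filter_upwards [hc.eventually hQ.1.eventually_analyticAt,
    hc.eventually (analyticAt_defect hQ).eventually_analyticAt] with χ h1 h2 i j
  rw [← cd_eq_qd, ← cd_dz h1, ← cd_dz h2, dz_defect]

theorem eventually_cd_defect_zero (hQ : IsNormalCoord Q) :
    ∀ᶠ χ in 𝓝 (0 : ℂ), ∀ j, cd (defect Q) 0 j χ = 0 := by
  have h : ∀ᶠ p : ℂ × ℂ in 𝓝 0, Q 0 p.1 p.2 = p.2 := hQ.2.2.1
  rw [show (0 : ℂ × ℂ) = (0, 0) from rfl] at h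
  filter_upwards [h.curry_nhds] with χ hχ j
  rw [cd, Function.iterate_zero, id, dt_iterate_apply]
  apply iterate_deriv_eq_zero
  filter_upwards [hχ] with τ hτ
  simpa [defect, sub_eq_zero] using hτ

theorem cd_defect_at_zero (hQ : IsNormalCoord Q) (i j : ℕ) : cd (defect Q) i j 0 = 0 := by
  have h : ∀ᶠ p : ℂ × ℂ in 𝓝 0, Q p.1 0 p.2 = p.2 := hQ.2.1
  rw [show (0 : ℂ × ℂ) = (0, 0) from rfl] at h
  rw [cd, dz_iterate_apply]
  apply iterate_deriv_eq_zero
  filter_upwards [h.curry_nhds] with z hz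
  rw [dt_iterate_apply]
  apply iterate_deriv_eq_zero
  filter_upwards [hz] with τ hτ
  simpa [defect, sub_eq_zero] using hτ

theorem eventually_cd_defect_of_imp (hQ : IsNormalCoord Q) {α μ : ℕ}
    (h : 1 ≤ α → ¬ QNontriv Q α μ) : ∀ᶠ χ in 𝓝 (0 : ℂ), cd (defect Q) α μ χ = 0 := by
  rcases α with _ | α
  · filter_upwards [eventually_cd_defect_zero hQ] with χ h' using h' μ
  · filter_upwards [eventually_cd_defect hQ, not_not.1 (h (by omega))] with χ h1 h2
    rw [h1, h2]

variable {α₀ μ₀ : ℕ}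

theorem eventually_cd_defect_of_lt (hQ : IsNormalCoord Q) (hI : IsInvariants Q α₀ μ₀) :
    ∀ᶠ χ in 𝓝 (0 : ℂ), ∀ i j, i + j < α₀ + μ₀ → cd (defect Q) i j χ = 0 := by
  have h : ∀ᶠ χ in 𝓝 (0 : ℂ), ∀ ij ∈ Finset.range (α₀ + μ₀) ×ˢ Finset.range (α₀ + μ₀),
      ij.1 + ij.2 < α₀ + μ₀ → cd (defect Q) ij.1 ij.2 χ = 0 := by
    refine (Filter.eventually_all_finset _).2 fun ij _ => Filter.eventually_imp_distrib_left.2 ?_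
    intro hlt
    refine eventually_cd_defect_of_imp hQ fun h1 h2 => ?_
    exact absurd (hI.2.2.1 _ _ h1 h2) (by omega)
  filter_upwards [h] with χ hχ i j hij
  exact hχ (i, j) (by simp; omega) hij

theorem eventually_cd_defect_of_eq (hQ : IsNormalCoord Q) (hI : IsInvariants Q α₀ μ₀) :
    ∀ᶠ χ in 𝓝 (0 : ℂ), ∀ i j, i + j = α₀ + μ₀ → α₀ < i → cd (defect Q) i j χ = 0 := by
  have h : ∀ᶠ χ in 𝓝 (0 : ℂ), ∀ ij ∈ Finset.HasAntidiagonal.antidiagonal (α₀ + μ₀),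
      α₀ < ij.1 → cd (defect Q) ij.1 ij.2 χ = 0 := by
    refine (Filter.eventually_all_finset _).2 fun ij hij =>
      Filter.eventually_imp_distrib_left.2 ?_
    intro hlt
    rw [Finset.HasAntidiagonal.mem_antidiagonal] at hij
    refine eventually_cd_defect_of_imp hQ fun h1 h2 => ?_
    exact absurd (hI.2.2.2 _ _ h1 h2 hij) (by omega)
  filter_upwards [h] with χ hχ i j hij
  exact hχ (i, j) (Finset.HasAntidiagonal.mem_antidiagonal.2 hij)

theorem eventually_cd_defect_ne_zero (hQ : IsNormalCoord Q) (hI : IsInvariants Q α₀ μ₀) :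
    ∀ᶠ χ in 𝓝[≠] (0 : ℂ), cd (defect Q) α₀ μ₀ χ ≠ 0 := by
  have han : AnalyticAt ℂ (fun χ => cd (defect Q) α₀ μ₀ χ) 0 := by
    have h1 : AnalyticAt ℂ (fun y : ℂ => ((0 : ℂ), y, (0 : ℂ))) 0 :=
      analyticAt_const.prod (analyticAt_id.prod analyticAt_const)
    exact AnalyticAt.comp (g := dz^[α₀] (dt^[μ₀] (defect Q)))
      (analyticAt_dz_iterate (analyticAt_dt_iterate (analyticAt_defect hQ) _) _) h1
  refine han.eventually_eq_zero_or_eventually_ne_zero.resolve_left fun h => hI.2.1 ?_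
  filter_upwards [h, eventually_cd_defect hQ] with χ h1 h2
  obtain ⟨α, rfl⟩ : ∃ α, α₀ = α + 1 := ⟨α₀ - 1, by have := hI.1; omega⟩
  rw [← h2, h1]

end NormalCoord

@[fun_prop]
theorem continuous_cj : Continuous cj := Complex.continuous_conj

theorem cj_zero : cj 0 = 0 := map_zero (starRingEnd ℂ)

theorem cj_cj (z : ℂ) : cj (cj z) = z := Complex.conj_conj z

theorem cj_mul (z w : ℂ) : cj (z * w) = cj z * cj w := map_mul (starRingEnd ℂ) z w

theorem cj_div (z w : ℂ) : cj (z / w) = cj z / cj w := map_div₀ (starRingEnd ℂ) z w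

theorem cj_eq_zero {z : ℂ} : cj z = 0 ↔ z = 0 := map_eq_zero (starRingEnd ℂ)

theorem tendsto_cj_zero : Tendsto cj (𝓝 0) (𝓝 0) := Continuous.tendsto' continuous_cj _ _ cj_zero

theorem tendsto_cj_punctured : Tendsto cj (𝓝[≠] 0) (𝓝[≠] 0) :=
  tendsto_nhdsWithin_of_tendsto_nhds_of_eventually_within _
    (tendsto_cj_zero.mono_left nhdsWithin_le_nhds)
    (eventually_mem_nhdsWithin.mono fun _ hz => mt cj_eq_zero.1 hz)

theorem tendsto_zero_of_div {w : ℂ → ℂ} {w₀ : ℂ}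
    (hw : Tendsto (fun t => w t / t) (𝓝[≠] 0) (𝓝 w₀)) : Tendsto w (𝓝[≠] 0) (𝓝 0) := by
  have ht : Tendsto (fun t : ℂ => t) (𝓝[≠] 0) (𝓝 0) := nhdsWithin_le_nhds
  have := hw.mul ht
  rw [mul_zero] at this
  refine this.congr' ?_
  filter_upwards [self_mem_nhdsWithin] with t h2
  exact div_mul_cancel₀ _ h2

theorem tendsto_div_of_hasFDerivAt {f : ℂ → ℂ → ℂ} {a : ℂ} {L : ℂ × ℂ →L[ℂ] ℂ}
    (hf : HasFDerivAt (fun p : ℂ × ℂ => f p.1 p.2) L (a, 0)) (h0 : f a 0 = 0) {z w : ℂ → ℂ}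
    {z₀ w₀ : ℂ} (hz : Tendsto (fun t => z t / t) (𝓝[≠] 0) (𝓝 z₀))
    (hw : Tendsto (fun t => w t / t) (𝓝[≠] 0) (𝓝 w₀)) :
    Tendsto (fun t => f (a + z t) (w t) / t) (𝓝[≠] 0) (𝓝 (L (z₀, w₀))) := by
  have h := (hf.hasFDerivWithinAt (s := Set.univ)).lim (c := fun t : ℂ => t⁻¹)
    (d := fun t => (z t, w t)) (v := (z₀, w₀)) (l := 𝓝[≠] 0)
    ((tendsto_zero_of_div hz).prodMk_nhds (tendsto_zero_of_div hw)) (by simp) (by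
      refine (hz.prodMk_nhds hw).congr fun t => ?_
      simp [div_eq_inv_mul])
  refine h.congr fun t => ?_
  simp [h0, div_eq_inv_mul]

theorem tendsto_cj_div_of_hasFDerivAt {f : ℂ → ℂ → ℂ} {a : ℂ} {L : ℂ × ℂ →L[ℂ] ℂ}
    (hf : HasFDerivAt (fun p : ℂ × ℂ => f p.1 p.2) L (a, 0)) (h0 : f a 0 = 0) {w : ℂ → ℂ}
    {w₀ : ℂ} (hw : Tendsto (fun t => w t / t) (𝓝[≠] 0) (𝓝 w₀)) :
    Tendsto (fun t => cj (f a (cj (w t))) / t) (𝓝[≠] 0) (𝓝 (cj (L (0, cj w₀)))) := by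
  have hw' : Tendsto (fun t => cj (w (cj t)) / t) (𝓝[≠] 0) (𝓝 (cj w₀)) := by
    refine ((continuous_cj.tendsto _).comp (hw.comp tendsto_cj_punctured)).congr fun t => ?_
    simp [cj_div, cj_cj]
  have hz : Tendsto (fun t : ℂ => (0 : ℂ) / t) (𝓝[≠] 0) (𝓝 0) := by simp
  have h := tendsto_div_of_hasFDerivAt hf h0 hz hw'
  refine ((continuous_cj.tendsto _).comp (h.comp tendsto_cj_punctured)).congr fun t => ?_
  simp [cj_div, cj_cj]

/-- The mapping identity at a point, written for the functions `Q - τ` and `Q' - τ`. -/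
def MapsAt (A A' : ℂ × ℂ × ℂ → ℂ) (F G : ℂ → ℂ → ℂ) (p : ℂ × ℂ × ℂ) : Prop :=
  G p.1 (p.2.2 + A p) = cj (G (cj p.2.1) (cj p.2.2)) +
    A' (F p.1 (p.2.2 + A p), cj (F (cj p.2.1) (cj p.2.2)), cj (G (cj p.2.1) (cj p.2.2)))

section Mapping

variable {A A' : ℂ × ℂ × ℂ → ℂ} {F G : ℂ → ℂ → ℂ}

theorem tendsto_normal_sub {n : ℕ} {LF LG : ℂ × ℂ →L[ℂ] ℂ}
    (hA' : AnalyticAt ℂ A' 0)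
    (hv : ∀ᶠ y in 𝓝 (0 : ℂ), ∀ i j, i + j < n → cd A' i j y = 0)
    (h0 : ∀ i j, cd A' i j 0 = 0)
    (hM : ∀ᶠ p in 𝓝 0, MapsAt A A' F G p)
    (hA : ∀ᶠ p : ℂ × ℂ in 𝓝 0, A (p.1, 0, p.2) = 0)
    (hF : HasFDerivAt (fun p : ℂ × ℂ => F p.1 p.2) LF 0)
    (hG : HasFDerivAt (fun p : ℂ × ℂ => G p.1 p.2) LG 0)
    (hF0 : F 0 0 = 0) (hG0 : G 0 0 = 0) {z w : ℂ → ℂ} {z₀ w₀ : ℂ}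
    (hz : Tendsto (fun t => z t / t) (𝓝[≠] 0) (𝓝 z₀))
    (hw : Tendsto (fun t => w t / t) (𝓝[≠] 0) (𝓝 w₀)) :
    Tendsto (fun t => (G (z t) (w t) - G 0 (w t)) / t ^ n) (𝓝[≠] 0) (𝓝 0) := by
  have hY : Tendsto (fun t => cj (F 0 (cj (w t)))) (𝓝[≠] 0) (𝓝 0) :=
    tendsto_zero_of_div (tendsto_cj_div_of_hasFDerivAt hF hF0 hw)
  have hV := tendsto_cj_div_of_hasFDerivAt hG hG0 hw
  have key : ∀ {z : ℂ → ℂ} {z₀ : ℂ}, Tendsto (fun t => z t / t) (𝓝[≠] 0) (𝓝 z₀) →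
      Tendsto (fun t => (G (z t) (w t) - cj (G 0 (cj (w t)))) / t ^ n) (𝓝[≠] 0) (𝓝 0) := by
    intro z z₀ hz
    have hX := tendsto_div_of_hasFDerivAt hF hF0 hz hw
    have h := tendsto_div_pow_homPart hA' hv hX hY hV
    have hh : homPart A' n 0 (LF (z₀, w₀)) (cj (LG (0, cj w₀))) = 0 := by
      simp [homPart, h0]
    rw [hh] at h
    refine h.congr' ?_
    have hp : Tendsto (fun t => (z t, (0 : ℂ), w t)) (𝓝[≠] 0) (𝓝 0) :=
      (tendsto_zero_of_div hz).prodMk_nhds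
        (tendsto_const_nhds.prodMk_nhds (tendsto_zero_of_div hw))
    have hp' : Tendsto (fun t => (z t, w t)) (𝓝[≠] 0) (𝓝 0) :=
      (tendsto_zero_of_div hz).prodMk_nhds (tendsto_zero_of_div hw)
    filter_upwards [hp.eventually hM, hp'.eventually hA] with t h1 h2
    simp only [MapsAt, h2, add_zero, cj_zero] at h1
    rw [h1, zero_add, add_sub_cancel_left]
  have hz0 : Tendsto (fun t : ℂ => (0 : ℂ) / t) (𝓝[≠] 0) (𝓝 0) := by simp
  have := (key hz).sub (key hz0)
  rw [sub_zero] at this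
  refine this.congr fun t => ?_
  ring

theorem exists_leading_terms {m n : ℕ} {χ : ℂ} {LF LG LG' : ℂ × ℂ →L[ℂ] ℂ} (hm : 1 ≤ m)
    (hA : AnalyticAt ℂ A (0, χ, 0))
    (hAv : ∀ᶠ y in 𝓝 χ, ∀ i j, i + j < m → cd A i j y = 0)
    (hA' : AnalyticAt ℂ A' (0, cj (F (cj χ) 0), 0))
    (hAv' : ∀ᶠ y in 𝓝 (cj (F (cj χ) 0)), ∀ i j, i + j < n → cd A' i j y = 0)
    (hA'0 : AnalyticAt ℂ A' 0)
    (hAv'0 : ∀ᶠ y in 𝓝 (0 : ℂ), ∀ i j, i + j < n → cd A' i j y = 0)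
    (hA'00 : ∀ i j, cd A' i j 0 = 0)
    (hM : ∀ᶠ p in 𝓝 (0, χ, 0), MapsAt A A' F G p)
    (hM0 : ∀ᶠ p in 𝓝 0, MapsAt A A' F G p)
    (hAz : ∀ᶠ p : ℂ × ℂ in 𝓝 0, A (p.1, 0, p.2) = 0)
    (hAχ : ∀ᶠ τ in 𝓝 (0 : ℂ), A (0, χ, τ) = 0)
    (hF : HasFDerivAt (fun p : ℂ × ℂ => F p.1 p.2) LF 0)
    (hFχ : ContinuousAt (fun p : ℂ × ℂ => F p.1 p.2) (cj χ, 0))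
    (hG : HasStrictFDerivAt (fun p : ℂ × ℂ => G p.1 p.2) LG 0)
    (hGχ : HasFDerivAt (fun p : ℂ × ℂ => G p.1 p.2) LG' (cj χ, 0))
    (hF0 : F 0 0 = 0) (hG0 : G 0 0 = 0) (hGχ0 : G (cj χ) 0 = 0) (ζ σ : ℂ) :
    ∃ (w₀ : ℂ) (D : ℂ → ℂ), (2 ≤ m → w₀ = σ) ∧
      Tendsto (fun t => D t / t ^ m) (𝓝[≠] 0) (𝓝 (LG (0, 1) * homPart A m χ ζ σ)) ∧
      Tendsto (fun t => D t / t ^ n) (𝓝[≠] 0)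
        (𝓝 (homPart A' n (cj (F (cj χ) 0)) (LF (ζ, w₀)) (cj (LG' (0, cj σ))) -
          homPart A' n (cj (F (cj χ) 0)) (LF (0, σ)) (cj (LG' (0, cj σ))))) := by
  have ht : Tendsto (fun t : ℂ => t) (𝓝[≠] 0) (𝓝 0) := nhdsWithin_le_nhds
  have hlin : ∀ c : ℂ, Tendsto (fun t : ℂ => t * c / t) (𝓝[≠] 0) (𝓝 c) := fun c => by
    refine tendsto_const_nhds.congr' ?_
    filter_upwards [self_mem_nhdsWithin] with t h2
    exact (mul_div_cancel_left₀ _ h2).symm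
  have hz0 : Tendsto (fun t : ℂ => (0 : ℂ) / t) (𝓝[≠] 0) (𝓝 0) := by simp
  have hAlim := tendsto_div_pow_homPart hA hAv (hlin ζ) (tendsto_const_nhds (x := χ)) (hlin σ)
  obtain ⟨k, rfl⟩ : ∃ k, m = k + 1 := ⟨m - 1, by omega⟩
  set P := homPart A (k + 1) χ ζ σ with hP
  set a : ℂ → ℂ := fun t => A (t * ζ, χ, t * σ) with ha
  have ha1 : Tendsto (fun t => a t / t) (𝓝[≠] 0) (𝓝 (0 ^ k * P)) := by
    refine ((ht.pow k).mul hAlim).congr' ?_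
    filter_upwards [self_mem_nhdsWithin] with t h2
    have h2' : t ≠ 0 := h2
    rw [pow_succ]
    field_simp
    rfl
  have hw : Tendsto (fun t => (t * σ + a t) / t) (𝓝[≠] 0) (𝓝 (σ + 0 ^ k * P)) := by
    refine ((hlin σ).add ha1).congr fun t => ?_
    ring
  have hsub := tendsto_normal_sub hA'0 hAv'0 hA'00 hM0 hAz hF hG.hasFDerivAt hF0 hG0 (hlin ζ) hw
  refine ⟨σ + 0 ^ k * P, fun t => G 0 (t * σ + a t) - G 0 (t * σ), ?_, ?_, ?_⟩
  · intro hk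
    rw [zero_pow (by omega)]; simp
  · have hs : HasStrictDerivAt (fun w => G 0 w) (LG (0, 1)) 0 :=
      HasStrictFDerivAt.comp_hasStrictDerivAt (f := fun w : ℂ => ((0 : ℂ), w)) 0 hG
        ((hasStrictDerivAt_const _ _).prodMk (hasStrictDerivAt_id _))
    have ho := (hasStrictFDerivAt_iff_isLittleO.1 hs.hasStrictFDerivAt)
    have htend : Tendsto (fun t : ℂ => (t * σ + a t, t * σ)) (𝓝[≠] 0) (𝓝 (0, 0)) :=
      (tendsto_zero_of_div hw).prodMk_nhds (tendsto_zero_of_div (hlin σ))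
    have ho' := ho.comp_tendsto htend
    have hO : a =O[𝓝[≠] 0] fun t => t ^ (k + 1) := by
      refine Asymptotics.isBigO_of_div_tendsto_nhds ?_ P hAlim
      filter_upwards [self_mem_nhdsWithin] with t h2 h3
      exact absurd h3 (pow_ne_zero _ h2)
    have hO' : ((fun p : ℂ × ℂ => p.1 - p.2) ∘ fun t : ℂ => (t * σ + a t, t * σ)) =O[𝓝[≠] 0]
        fun t => t ^ (k + 1) := by
      refine hO.congr_left fun t => ?_
      simp
    have := (ho'.trans_isBigO hO').tendsto_div_nhds_zero.add (hAlim.const_mul (LG (0, 1)))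
    rw [zero_add] at this
    refine this.congr fun t => ?_
    simp [ha]
    ring
  · have hY : Tendsto (fun t => cj (F (cj χ) (cj (t * σ)))) (𝓝[≠] 0) (𝓝 (cj (F (cj χ) 0))) := by
      have h1 : Tendsto (fun t => (cj χ, cj (t * σ))) (𝓝[≠] 0) (𝓝 (cj χ, 0)) :=
        tendsto_const_nhds.prodMk_nhds (tendsto_cj_zero.comp (tendsto_zero_of_div (hlin σ)))
      exact (continuous_cj.tendsto _).comp (hFχ.tendsto.comp h1)
    have hV := tendsto_cj_div_of_hasFDerivAt hGχ hGχ0 (hlin σ)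
    have hX1 := tendsto_div_of_hasFDerivAt hF hF0 (hlin ζ) hw
    have hX2 := tendsto_div_of_hasFDerivAt hF hF0 hz0 (hlin σ)
    have h1 := tendsto_div_pow_homPart hA' hAv' hX1 hY hV
    have h2 := tendsto_div_pow_homPart hA' hAv' hX2 hY hV
    have h3 := (h1.sub h2).sub hsub
    rw [sub_zero] at h3
    refine h3.congr' ?_
    have hp1 : Tendsto (fun t => (t * ζ, χ, t * σ)) (𝓝[≠] 0) (𝓝 (0, χ, 0)) :=
      (tendsto_zero_of_div (hlin ζ)).prodMk_nhds
        (tendsto_const_nhds.prodMk_nhds (tendsto_zero_of_div (hlin σ)))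
    have hp2 : Tendsto (fun t => ((0 : ℂ), χ, t * σ)) (𝓝[≠] 0) (𝓝 (0, χ, 0)) :=
      tendsto_const_nhds.prodMk_nhds
        (tendsto_const_nhds.prodMk_nhds (tendsto_zero_of_div (hlin σ)))
    filter_upwards [hp1.eventually hM, hp2.eventually hM,
      (tendsto_zero_of_div (hlin σ)).eventually hAχ] with t e1 e2 e3
    simp only [MapsAt, e3, add_zero] at e1 e2
    simp only [zero_add, ha] at e1 ⊢
    rw [e1, e2]
    ring

end Mapping

theorem eq_zero_of_tendsto_div_pow {D : ℂ → ℂ} {m n : ℕ} {p r : ℂ} (hmn : m < n)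
    (hp : Tendsto (fun t => D t / t ^ m) (𝓝[≠] 0) (𝓝 p))
    (hr : Tendsto (fun t => D t / t ^ n) (𝓝[≠] 0) (𝓝 r)) : p = 0 := by
  have ht : Tendsto (fun t : ℂ => t ^ (n - m)) (𝓝[≠] 0) (𝓝 0) := by
    have : Tendsto (fun t : ℂ => t) (𝓝[≠] 0) (𝓝 0) := nhdsWithin_le_nhds
    simpa [zero_pow (Nat.sub_ne_zero_of_lt hmn)] using this.pow (n - m)
  have h := hr.mul ht
  rw [mul_zero] at h
  refine tendsto_nhds_unique hp (h.congr' ?_)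
  filter_upwards [self_mem_nhdsWithin] with t h2
  have h2' : t ≠ 0 := h2
  have : t ^ n = t ^ m * t ^ (n - m) := by rw [← pow_add]; congr 1; omega
  rw [this]
  field_simp

theorem eventually_mapsAt {Q Q' : ℂ → ℂ → ℂ → ℂ} {F G : ℂ → ℂ → ℂ} (h : SendsInto Q Q' F G) :
    ∀ᶠ p in 𝓝 0, MapsAt (defect Q) (defect Q') F G p := by
  filter_upwards [h.2.2.2.2] with p hp
  simpa [MapsAt, defect] using hp

theorem eventually_normal {Q Q' : ℂ → ℂ → ℂ → ℂ} {F G : ℂ → ℂ → ℂ} (hQ : IsNormalCoord Q)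
    (hQ' : IsNormalCoord Q') (h : SendsInto Q Q' F G) : ∀ᶠ z in 𝓝 (0 : ℂ), G z 0 = 0 := by
  have hM := eventually_mapsAt h
  obtain ⟨hF, -, hF0, hG0, -⟩ := h
  have h1 : Tendsto (fun z : ℂ => (z, (0 : ℂ), (0 : ℂ))) (𝓝 0) (𝓝 0) :=
    Continuous.tendsto' (by fun_prop) _ _ rfl
  have h2 : Tendsto (fun z : ℂ => (z, (0 : ℂ))) (𝓝 0) (𝓝 0) :=
    Continuous.tendsto' (by fun_prop) _ _ rfl
  have h3 : Tendsto (fun z : ℂ => (F z 0, (0 : ℂ))) (𝓝 0) (𝓝 0) := by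
    refine Tendsto.prodMk_nhds ?_ tendsto_const_nhds
    have := hF.continuousAt.tendsto.comp h2
    simpa [hF0, Function.comp_def] using this
  filter_upwards [h1.eventually hM, h2.eventually hQ.2.1, h3.eventually hQ'.2.1] with z e1 e2 e3
  simpa [MapsAt, defect, e2, e3, cj_zero, hF0, hG0] using e1

/-- Proposition 3.2: the integers `m₀`, `α₀`, `μ₀` are biholomorphic
invariants: if some local biholomorphism sends `M` into `M'`, then `α₀ = α₀'` and
`μ₀ = μ₀'` (hence `m₀ = m₀'`). -/
theorem invariants_are_biholomorphic_invariants
    (Q Q' : ℂ → ℂ → ℂ → ℂ) (hQ : IsNormalCoord Q) (hQ' : IsNormalCoord Q')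
    (hLF : NotLeviFlat Q) (hLF' : NotLeviFlat Q')
    (α₀ μ₀ α₀' μ₀' : ℕ) (hI : IsInvariants Q α₀ μ₀) (hI' : IsInvariants Q' α₀' μ₀')
    (F G : ℂ → ℂ → ℂ) (h : SendsInto Q Q' F G) (hb : JacDet F G ≠ 0) :
    α₀ = α₀' ∧ μ₀ = μ₀' := by
  have hM := eventually_mapsAt h
  have hGz := eventually_normal hQ hQ' h
  obtain ⟨hF, hG, hF0, hG0, -⟩ := h
  have hα := hI.1
  have hα' := hI'.1
  set LF := fderiv ℂ (fun p : ℂ × ℂ => F p.1 p.2) 0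
  set LG := fderiv ℂ (fun p : ℂ × ℂ => G p.1 p.2) 0
  have hFd : HasFDerivAt (fun p : ℂ × ℂ => F p.1 p.2) LF 0 := hF.differentiableAt.hasFDerivAt
  have hGd : HasStrictFDerivAt (fun p : ℂ × ℂ => G p.1 p.2) LG 0 := hG.hasStrictFDerivAt
  -- the Jacobian determinant is the product of the diagonal entries
  have hFz : HasDerivAt (fun z => F z 0) (LF (1, 0)) 0 :=
    HasFDerivAt.comp_hasDerivAt (f := fun z : ℂ => (z, (0 : ℂ))) 0 hFd
      ((hasDerivAt_id _).prodMk (hasDerivAt_const _ _))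
  have hGw : HasDerivAt (fun w => G 0 w) (LG (0, 1)) 0 :=
    HasFDerivAt.comp_hasDerivAt (f := fun w : ℂ => ((0 : ℂ), w)) 0 hGd.hasFDerivAt
      ((hasDerivAt_const _ _).prodMk (hasDerivAt_id _))
  have hjac : LF (1, 0) * LG (0, 1) ≠ 0 := by
    have e1 : pd F 1 0 0 0 = LF (1, 0) := hFz.deriv
    have e2 : pd G 0 1 0 0 = LG (0, 1) := hGw.deriv
    have e3 : pd G 1 0 0 0 = 0 := iterate_deriv_eq_zero hGz 1
    rwa [JacDet, e1, e2, e3, mul_zero, sub_zero] at hb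
  have ha : LF (1, 0) ≠ 0 := left_ne_zero_of_mul hjac
  have hc : LG (0, 1) ≠ 0 := right_ne_zero_of_mul hjac
  -- the two ways of approaching the origin
  have hline : Tendsto (fun χ : ℂ => ((0 : ℂ), χ, (0 : ℂ))) (𝓝 0) (𝓝 0) :=
    Continuous.tendsto' (by fun_prop) _ _ rfl
  have hcj : Tendsto (fun χ : ℂ => (cj χ, (0 : ℂ))) (𝓝 0) (𝓝 0) :=
    tendsto_cj_zero.prodMk_nhds tendsto_const_nhds
  have hφ : Tendsto (fun χ => cj (F (cj χ) 0)) (𝓝 0) (𝓝 0) := by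
    have := tendsto_cj_zero.comp (x := 𝓝 (0 : ℂ)) (f := fun χ => F (cj χ) 0) (by
      have := hF.continuousAt.tendsto.comp hcj
      simpa [hF0, Function.comp_def] using this)
    exact this
  have hφ' : Tendsto (fun χ => cj (F (cj χ) 0)) (𝓝[≠] 0) (𝓝[≠] 0) := by
    refine tendsto_nhdsWithin_of_tendsto_nhds_of_eventually_within _
      (hφ.mono_left nhdsWithin_le_nhds) ?_
    have := hFz.eventually_ne (c := 0) ha
    filter_upwards [tendsto_cj_punctured.eventually this] with χ hχ
    exact mt cj_eq_zero.1 hχ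
  have hLGne : ∀ᶠ χ in 𝓝 (0 : ℂ),
      fderiv ℂ (fun p : ℂ × ℂ => G p.1 p.2) (cj χ, 0) (0, 1) ≠ 0 := by
    have hcont : ContinuousAt
        (fun q => fderiv ℂ (fun p : ℂ × ℂ => G p.1 p.2) q ((0 : ℂ), (1 : ℂ))) 0 :=
      hG.fderiv.continuousAt.clm_apply continuousAt_const
    exact hcj.eventually (hcont.eventually_ne hc)
  have hAz : ∀ᶠ p : ℂ × ℂ in 𝓝 0, defect Q (p.1, 0, p.2) = 0 := by
    filter_upwards [hQ.2.1] with p hp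
    simpa [defect, sub_eq_zero] using hp
  have hAχ : ∀ᶠ χ in 𝓝 (0 : ℂ), ∀ᶠ τ in 𝓝 (0 : ℂ), defect Q (0, χ, τ) = 0 := by
    have h0 : ∀ᶠ p : ℂ × ℂ in 𝓝 0, Q 0 p.1 p.2 = p.2 := hQ.2.2.1
    rw [show (0 : ℂ × ℂ) = (0, 0) from rfl] at h0
    filter_upwards [h0.curry_nhds] with χ hχ
    filter_upwards [hχ] with τ hτ
    simpa [defect, sub_eq_zero] using hτ
  have hA := analyticAt_defect hQ
  have hA' := analyticAt_defect hQ'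
  have hlt := eventually_cd_defect_of_lt hQ hI
  have hlt' := eventually_cd_defect_of_lt hQ' hI'
  have hall := (hline.eventually hA.eventually_analyticAt).and
    (hlt.eventually_nhds.and ((hφ.eventually (hline.eventually hA'.eventually_analyticAt)).and
    ((hφ.eventually hlt'.eventually_nhds).and ((hline.eventually hM.eventually_nhds).and
    (hAχ.and ((hcj.eventually hF.eventually_analyticAt).and
    ((hcj.eventually hG.eventually_analyticAt).and ((tendsto_cj_zero.eventually hGz).and
    (hLGne.and ((eventually_cd_defect_of_eq hQ hI).and
    (hφ.eventually (eventually_cd_defect_of_eq hQ' hI'))))))))))))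
  obtain ⟨χ, ⟨c1, c2, c3, c4, c5, c6, c7, c8, c9, c10, c11, c12⟩, c13, c14⟩ :=
    ((hall.filter_mono nhdsWithin_le_nhds).and
      ((eventually_cd_defect_ne_zero hQ hI).and
        (hφ'.eventually (eventually_cd_defect_ne_zero hQ' hI')))).exists
  have hlead := fun ζ => exists_leading_terms (LF := LF) (LG := LG) (by omega) c1 c2 c3 c4 hA'
    hlt' (cd_defect_at_zero hQ') c5 hM hAz c6 hFd c7.continuousAt hGd
    c8.differentiableAt.hasFDerivAt hF0 hG0 c9 ζ 1
  set φ := cj (F (cj χ) 0)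
  set v := cj (fderiv ℂ (fun p : ℂ × ℂ => G p.1 p.2) (cj χ, 0) (0, cj 1)) with hv
  have hv0 : v ≠ 0 := by
    rw [hv, show cj 1 = 1 from map_one (starRingEnd ℂ)]
    exact mt cj_eq_zero.1 c10
  set p := homPoly (defect Q) (α₀ + μ₀) χ 1 with hp
  set p' := homPoly (defect Q') (α₀' + μ₀') φ v with hp'
  have hdeg : p.natDegree = α₀ := natDegree_homPoly one_ne_zero c13 c11
  have hdeg' : p'.natDegree = α₀' := natDegree_homPoly hv0 c14 c12
  set l := Polynomial.C (LF (1, 0)) * Polynomial.X + Polynomial.C (LF (0, 1)) with hl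
  have hldeg : l.natDegree = 1 := Polynomial.natDegree_linear ha
  have hleval : ∀ ζ, LF (ζ, 1) = l.eval ζ := fun ζ => by
    have : ((ζ, 1) : ℂ × ℂ) = ζ • (1, 0) + (0, 1) := by simp
    rw [this, map_add, map_smul, hl]
    simp only [Polynomial.eval_add, Polynomial.eval_mul, Polynomial.eval_C, Polynomial.eval_X,
      smul_eq_mul]
    ring
  set r := p'.comp l - Polynomial.C (p'.eval (LF (0, 1))) with hr
  have hrdeg : r.natDegree = α₀' := by
    rw [hr, Polynomial.natDegree_sub_C, Polynomial.natDegree_comp, hldeg, hdeg', mul_one]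
  have hreval : ∀ ζ, r.eval ζ = homPart (defect Q') (α₀' + μ₀') φ (LF (ζ, 1)) v -
      homPart (defect Q') (α₀' + μ₀') φ (LF (0, 1)) v := fun ζ => by
    rw [hr, hleval ζ, ← eval_homPoly, ← eval_homPoly]
    simp [Polynomial.eval_comp, hp']
  rcases lt_trichotomy (α₀ + μ₀) (α₀' + μ₀') with hmn | hmn | hmn
  · exfalso
    have : p = 0 := Polynomial.funext fun ζ => by
      obtain ⟨w₀, D, -, h1, h2⟩ := hlead ζ
      rw [hp, eval_homPoly, Polynomial.eval_zero]
      exact (mul_eq_zero.1 (eq_zero_of_tendsto_div_pow hmn h1 h2)).resolve_left hc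
    rw [this, Polynomial.natDegree_zero] at hdeg
    omega
  · rcases Nat.lt_or_ge (α₀ + μ₀) 2 with hlt2 | hge
    · omega
    have : Polynomial.C (LG (0, 1)) * p = r := Polynomial.funext fun ζ => by
      obtain ⟨w₀, D, h0, h1, h2⟩ := hlead ζ
      obtain rfl := h0 hge
      rw [hmn] at h1
      rw [hreval, hp, Polynomial.eval_mul, Polynomial.eval_C, eval_homPoly, hmn]
      exact tendsto_nhds_unique h1 h2
    have hd := congrArg Polynomial.natDegree this
    rw [Polynomial.natDegree_C_mul hc, hdeg, hrdeg] at hd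
    omega
  · exfalso
    have : r = 0 := Polynomial.funext fun ζ => by
      obtain ⟨w₀, D, h0, h1, h2⟩ := hlead ζ
      obtain rfl := h0 (by omega)
      rw [hreval, Polynomial.eval_zero]
      exact eq_zero_of_tendsto_div_pow hmn h2 h1
    rw [this, Polynomial.natDegree_zero] at hrdeg
    omega
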